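/- arXiv:2605.14089 — 3 statements merged into one kernel-verified Lean document; each statement's English description precedes it below -/
import Mathlib

section
/- Let V be a type, F : V → ℝ a state-flow function, f : V → V → ℝ an edge-flow function, T a natural number, and s : Fin (T+1) → V a path such that F(s(t)) ≠ 0 for every t. Then F(s(0)) · ∏_{t=0}^{T-1} ( f(s(t), s(t+1)) / F(s(t)) ) = F(s(T)) · ∏_{t=0}^{T-1} ( f(s(t), s(t+1)) / F(s(t+1)) ). In particular, when F(s(0)) = Z is the partition function and F(s(T)) = R(s(T)) is the reward of the terminal state (reward-matching), this is the Trajectory Balance identity Z · ∏ P_F(s(t+1)|s(t)) = R(s(T)) · ∏ P_B(s(t)|s(t+1)). -/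
open Finset

/-- Trajectory Balance identity (forward direction, reward-matching flow).
For a state-flow `F`, an edge-flow `f`, and a path `s : Fin (T+1) → V` with
`F (s t) ≠ 0` for every `t`, we have
`F (s 0) * ∏ t, (f (s t) (s (t+1)) / F (s t)) = F (s T) * ∏ t, (f (s t) (s (t+1)) / F (s (t+1)))`,
i.e. `Z · ∏ P_F = R · ∏ P_B` when `F (s 0) = Z` and `F (s T) = R (s T)`. -/
theorem trajectory_balance {V : Type*} (F : V → ℝ) (f : V → V → ℝ) (T : ℕ)
    (s : Fin (T + 1) → V) (hF : ∀ t, F (s t) ≠ 0) :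
    F (s 0) * ∏ t : Fin T, (f (s t.castSucc) (s t.succ) / F (s t.castSucc)) =
      F (s (Fin.last T)) * ∏ t : Fin T, (f (s t.castSucc) (s t.succ) / F (s t.succ)) := by
  have h1 := Fin.prod_univ_succ (fun t => F (s t))
  rw [Fin.prod_univ_castSucc] at h1
  have ha : ∏ t : Fin T, F (s t.castSucc) ≠ 0 := Finset.prod_ne_zero_iff.mpr fun t _ => hF _
  have hb : ∏ t : Fin T, F (s t.succ) ≠ 0 := Finset.prod_ne_zero_iff.mpr fun t _ => hF _
  rw [Finset.prod_div_distrib, Finset.prod_div_distrib, ← mul_div_assoc, ← mul_div_assoc,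
    div_eq_div_iff ha hb]
  linear_combination (-(∏ t : Fin T, f (s t.castSucc) (s t.succ))) * h1
end

section
/- Let V be a finite type, c : V → V → Prop a child relation such that (i) each node has at most one parent (for all u, v, w, if c u w and c v w then u = v), and (ii) there is a depth function d : V → ℕ with d(u) < d(w) whenever c u w. Call a node x a leaf if it has no children. Let F : V → ℝ satisfy flow conservation at every non-leaf node s: F(s) = ∑_{v : c s v} F(v) (the sum over the children of s). Then for every node s, F(s) = ∑_{x leaf, Relation.ReflTransGen c s x} F(x), i.e. the flow at s equals the sum of the flows at the leaf descendants of s. In particular, a reward-matching flow on such a tree-structured DAG is uniquely determined by its terminal (leaf) values. -/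
open Finset

/- Tree-DAG specialization: on a finite tree-structured DAG (unique parents, strictly
increasing depth along edges), a flow `F` satisfying conservation at every non-leaf node
(`F s` equals the sum of `F` over the children of `s`) is determined by its leaf values:
`F s` equals the sum of `F x` over the leaf descendants `x` of `s`. -/
open Classical in
theorem flow_eq_sum_leaf_descendants {V : Type*} [Fintype V] (c : V → V → Prop)
    (hparent : ∀ u v w, c u w → c v w → u = v)
    (d : V → ℕ) (hd : ∀ u w, c u w → d u < d w)
    (F : V → ℝ)
    (hcons : ∀ s : V, (∃ v, c s v) →
      F s = ∑ v ∈ Finset.univ.filter (fun v => c s v), F v) :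
    ∀ s : V, F s = ∑ x ∈ Finset.univ.filter
      (fun x => (¬ ∃ v, c x v) ∧ Relation.ReflTransGen c s x), F x := by
  have hmono : ∀ a b, Relation.ReflTransGen c a b → d a ≤ d b := by
    intro a b h
    induction h with
    | refl => exact le_rfl
    | tail _ h ih => exact ih.trans (hd _ _ h).le
  have hkey : ∀ s v w, c s v → c s w → Relation.ReflTransGen c v w → v = w := by
    intro s v w hv hw h
    rcases Relation.ReflTransGen.cases_tail h with h | ⟨p, hp, hpw⟩
    · exact h.symm
    · have : p = s := hparent _ _ _ hpw hw
      subst this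
      have h1 := hmono _ _ hp
      have h2 := hd _ _ hv
      omega
  have htot : ∀ v w x, Relation.ReflTransGen c v x → Relation.ReflTransGen c w x →
      Relation.ReflTransGen c v w ∨ Relation.ReflTransGen c w v := by
    intro v w x h
    induction h with
    | refl => intro h; exact Or.inr h
    | tail h1 h2 ih =>
      intro h
      rcases Relation.ReflTransGen.cases_tail h with h | ⟨p, hp, hpw⟩
      · subst h
        exact Or.inl (h1.tail h2)
      · have := hparent _ _ _ hpw h2
        subst this
        exact ih hp
  have main : ∀ n, ∀ s, Finset.univ.sup d - d s ≤ n → F s = ∑ x ∈ Finset.univ.filter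
      (fun x => (¬ ∃ v, c x v) ∧ Relation.ReflTransGen c s x), F x := by
    intro n
    induction n with
    | zero =>
      intro s hs
      have hleaf : ¬ ∃ v, c s v := by
        rintro ⟨v, hv⟩
        have h1 := hd _ _ hv
        have h2 : d v ≤ Finset.univ.sup d := Finset.le_sup (Finset.mem_univ v)
        omega
      have : Finset.univ.filter
          (fun x => (¬ ∃ v, c x v) ∧ Relation.ReflTransGen c s x) = {s} := by
        ext x
        simp only [Finset.mem_filter, Finset.mem_univ, true_and, Finset.mem_singleton]
        constructor
        · rintro ⟨_, h⟩
          rcases Relation.ReflTransGen.cases_head h with h | ⟨p, hp, _⟩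
          · exact h.symm
          · exact absurd ⟨p, hp⟩ hleaf
        · rintro rfl
          exact ⟨hleaf, .refl⟩
      rw [this, Finset.sum_singleton]
    | succ n ih =>
      intro s hs
      by_cases hleaf : ∃ v, c s v
      · have : Finset.univ.filter
            (fun x => (¬ ∃ v, c x v) ∧ Relation.ReflTransGen c s x) =
            (Finset.univ.filter (fun v => c s v)).biUnion (fun v => Finset.univ.filter
              (fun x => (¬ ∃ v, c x v) ∧ Relation.ReflTransGen c v x)) := by
          ext x
          simp only [Finset.mem_filter, Finset.mem_univ, true_and, Finset.mem_biUnion]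
          constructor
          · rintro ⟨hx, h⟩
            rcases Relation.ReflTransGen.cases_head h with h | ⟨p, hp, hpx⟩
            · subst h
              exact absurd hleaf hx
            · exact ⟨p, hp, hx, hpx⟩
          · rintro ⟨p, hp, hx, hpx⟩
            exact ⟨hx, .head hp hpx⟩
        rw [this, Finset.sum_biUnion, hcons s hleaf]
        · apply Finset.sum_congr rfl
          intro v hv
          have hv := (Finset.mem_filter.1 hv).2
          apply ih
          have h1 := hd _ _ hv
          omega
        · intro v hv w hw hne
          have hv : c s v := by simpa using hv
          have hw : c s w := by simpa using hw
          refine Finset.disjoint_left.2 fun x hx hx' => hne ?_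
          have hx := (Finset.mem_filter.1 hx).2.2
          have hx' := (Finset.mem_filter.1 hx').2.2
          rcases htot _ _ _ hx hx' with h | h
          · exact hkey s _ _ hv hw h
          · exact (hkey s _ _ hw hv h).symm
      · have : Finset.univ.filter
            (fun x => (¬ ∃ v, c x v) ∧ Relation.ReflTransGen c s x) = {s} := by
          ext x
          simp only [Finset.mem_filter, Finset.mem_univ, true_and, Finset.mem_singleton]
          constructor
          · rintro ⟨_, h⟩
            rcases Relation.ReflTransGen.cases_head h with h | ⟨p, hp, _⟩
            · exact h.symm
            · exact absurd ⟨p, hp⟩ hleaf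
          · rintro rfl
            exact ⟨hleaf, .refl⟩
        rw [this, Finset.sum_singleton]
  exact fun s => main _ s le_rfl
end

section
/- Let T be a nonempty finite set, R : T → ℝ with R(τ) > 0 for all τ, and β > 0. For every probability vector π : T → ℝ (π(τ) ≥ 0, ∑_τ π(τ) = 1), the entropy-regularized objective J(π) = ∑_τ π(τ)·log R(τ) + (1/β)·H(π), where H(π) = −∑_τ π(τ)·log π(τ) with the convention 0·log 0 = 0, satisfies J(π) ≤ (1/β)·log( ∑_τ R(τ)^β ), with equality if and only if π(τ) = R(τ)^β / ∑_{τ'} R(τ')^β for all τ (real powers). -/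
open Finset Real

lemma gibbs_aux (p q : ℝ) (hp : 0 ≤ p) (hq : 0 < q) :
    0 ≤ q - p - p * Real.log q + p * Real.log p ∧
    (q - p - p * Real.log q + p * Real.log p = 0 → p = q) := by
  rcases hp.eq_or_lt with h | h
  · subst h
    simp only [zero_mul, sub_zero, add_zero]
    exact ⟨hq.le, fun h => h.symm⟩
  · have e : q - p - p * Real.log q + p * Real.log p
        = p * ((q / p - 1) - Real.log (q / p)) := by
      rw [Real.log_div hq.ne' h.ne']
      field_simp
      ring
    rw [e]
    constructor
    · exact mul_nonneg h.le (sub_nonneg.2 (Real.log_le_sub_one_of_pos (div_pos hq h)))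
    · intro h0
      by_contra hne
      have h1 : q / p ≠ 1 := by
        intro h2
        rw [div_eq_one_iff_eq h.ne'] at h2
        exact hne h2.symm
      have := mul_pos h (sub_pos.2 (Real.log_lt_sub_one_of_pos (div_pos hq h) h1))
      linarith

/-- GFlowNet–RL equivalence: for positive rewards `R` on a nonempty finite set and
temperature exponent `β > 0`, every probability vector `p` satisfies
`J(p) = ∑ p(τ) log R(τ) + (1/β) H(p) ≤ (1/β) log (∑ R(τ)^β)`, with equality iff
`p` is the tempered distribution `p(τ) = R(τ)^β / ∑ R(τ')^β` (real powers).
(Here `Real.log 0 = 0`, so the convention `0 · log 0 = 0` holds automatically.) -/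
theorem entropy_regularized_objective_le {T : Type*} [Fintype T] [Nonempty T]
    (R : T → ℝ) (hR : ∀ τ, 0 < R τ) (β : ℝ) (hβ : 0 < β)
    (p : T → ℝ) (hp : ∀ τ, 0 ≤ p τ) (hsum : ∑ τ, p τ = 1) :
    ((∑ τ, p τ * Real.log (R τ)) + (1 / β) * (-∑ τ, p τ * Real.log (p τ)) ≤
        (1 / β) * Real.log (∑ τ, R τ ^ β)) ∧
    (((∑ τ, p τ * Real.log (R τ)) + (1 / β) * (-∑ τ, p τ * Real.log (p τ)) =
        (1 / β) * Real.log (∑ τ, R τ ^ β)) ↔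
      ∀ τ, p τ = R τ ^ β / ∑ τ', R τ' ^ β) := by
  have hw : ∀ τ, 0 < R τ ^ β := fun τ => Real.rpow_pos_of_pos (hR τ) β
  have hZ : 0 < ∑ τ, R τ ^ β := Finset.sum_pos (fun τ _ => hw τ) Finset.univ_nonempty
  set Z := ∑ τ, R τ ^ β with hZdef
  have hq : ∀ τ, 0 < R τ ^ β / Z := fun τ => div_pos (hw τ) hZ
  have hqs : ∑ τ, R τ ^ β / Z = 1 := by
    rw [← Finset.sum_div, ← hZdef, div_self hZ.ne']
  have key : ∑ τ, (R τ ^ β / Z - p τ - p τ * Real.log (R τ ^ β / Z) + p τ * Real.log (p τ))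
      = Real.log Z - β * (∑ τ, p τ * Real.log (R τ)) + ∑ τ, p τ * Real.log (p τ) := by
    have e : ∑ τ, p τ * Real.log (R τ ^ β / Z)
        = β * (∑ τ, p τ * Real.log (R τ)) - Real.log Z := by
      have : ∀ τ, p τ * Real.log (R τ ^ β / Z)
          = β * (p τ * Real.log (R τ)) - p τ * Real.log Z := by
        intro τ
        rw [Real.log_div (hw τ).ne' hZ.ne', Real.log_rpow (hR τ)]
        ring
      simp only [this]
      rw [Finset.sum_sub_distrib, ← Finset.mul_sum, ← Finset.sum_mul, hsum, one_mul]
    rw [Finset.sum_add_distrib, Finset.sum_sub_distrib, Finset.sum_sub_distrib, hqs, hsum, e]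
    ring
  have diff : (1 / β) * Real.log Z -
      ((∑ τ, p τ * Real.log (R τ)) + (1 / β) * (-∑ τ, p τ * Real.log (p τ)))
      = (1 / β) * ∑ τ, (R τ ^ β / Z - p τ - p τ * Real.log (R τ ^ β / Z)
        + p τ * Real.log (p τ)) := by
    rw [key]
    field_simp
    ring
  have hnn : ∀ τ ∈ Finset.univ, 0 ≤ R τ ^ β / Z - p τ - p τ * Real.log (R τ ^ β / Z)
      + p τ * Real.log (p τ) := fun τ _ => (gibbs_aux _ _ (hp τ) (hq τ)).1
  have hb : 0 < 1 / β := by positivity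
  refine ⟨?_, ?_, ?_⟩
  · have := mul_nonneg hb.le (Finset.sum_nonneg hnn)
    linarith
  · intro h τ
    rw [h, sub_self] at diff
    have h0 := (mul_eq_zero.1 diff.symm).resolve_left hb.ne'
    exact (gibbs_aux _ _ (hp τ) (hq τ)).2
      ((Finset.sum_eq_zero_iff_of_nonneg hnn).1 h0 τ (Finset.mem_univ τ))
  · intro h
    have h0 : ∑ τ, (R τ ^ β / Z - p τ - p τ * Real.log (R τ ^ β / Z)
        + p τ * Real.log (p τ)) = 0 := by
      apply Finset.sum_eq_zero
      intro τ _
      rw [← h τ]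
      ring
    rw [h0, mul_zero] at diff
    linarith
end
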